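/- arXiv:2309.05121 — 3 statements merged into one kernel-verified Lean document; each statement's English description precedes it below -/
import Mathlib

section
/- Let a > 0 and b > 0 be real numbers, and define F_a(w) = (∫₀^w t^(a-1)·(1-t)^(a-1) dt)/(∫₀¹ t^(a-1)·(1-t)^(a-1) dt) and similarly F_b. If F_a(w) = F_b(w) for all w ∈ (0,1), then a = b. -/
open MeasureTheory intervalIntegral

theorem intervalIntegrable_rpow_mul_one_sub_rpow_left {u : ℝ} (hu : 0 < u) (v : ℝ) :
    IntervalIntegrable (fun t : ℝ => t ^ (u - 1) * (1 - t) ^ (v - 1)) volume 0 (1 / 2) := by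
  apply IntervalIntegrable.mul_continuousOn
  · exact intervalIntegrable_rpow' (by linarith)
  · intro x hx
    rw [Set.uIcc_of_le (by norm_num)] at hx
    apply ContinuousAt.continuousWithinAt
    exact ContinuousAt.rpow_const (by fun_prop) (Or.inl (by linarith [hx.2]))

theorem intervalIntegrable_rpow_mul_one_sub_rpow {u v : ℝ} (hu : 0 < u) (hv : 0 < v) :
    IntervalIntegrable (fun t : ℝ => t ^ (u - 1) * (1 - t) ^ (v - 1)) volume 0 1 := by
  refine (intervalIntegrable_rpow_mul_one_sub_rpow_left hu v).trans ?_
  have h := ((intervalIntegrable_rpow_mul_one_sub_rpow_left hv u).comp_sub_left 1).symm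
  norm_num at h
  simpa only [mul_comm, one_div] using h

theorem integral_rpow_mul_one_sub_rpow_pos {u v : ℝ} (hu : 0 < u) (hv : 0 < v) :
    0 < ∫ t in (0 : ℝ)..1, t ^ (u - 1) * (1 - t) ^ (v - 1) := by
  refine intervalIntegral_pos_of_pos_on (intervalIntegrable_rpow_mul_one_sub_rpow hu hv) ?_
    one_pos
  rintro t ⟨h0, h1⟩
  have : 0 < 1 - t := sub_pos.2 h1
  positivity

theorem hasDerivAt_integral_rpow_mul_one_sub_rpow {u v w : ℝ} (hu : 0 < u) (hv : 0 < v)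
    (hw : w ∈ Set.Ioo (0 : ℝ) 1) :
    HasDerivAt (fun x => ∫ t in (0 : ℝ)..x, t ^ (u - 1) * (1 - t) ^ (v - 1))
      (w ^ (u - 1) * (1 - w) ^ (v - 1)) w := by
  have hcont : ContinuousOn (fun t : ℝ => t ^ (u - 1) * (1 - t) ^ (v - 1)) (Set.Ioo 0 1) :=
    (continuousOn_id.rpow_const fun x hx => Or.inl hx.1.ne').mul
      ((continuousOn_const.sub continuousOn_id).rpow_const
        fun x hx => Or.inl (sub_pos.2 hx.2).ne')
  refine integral_hasDerivAt_right ?_ (hcont.stronglyMeasurableAtFilter isOpen_Ioo w hw)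
    (hcont.continuousAt (isOpen_Ioo.mem_nhds hw))
  refine (intervalIntegrable_rpow_mul_one_sub_rpow hu hv).mono_set ?_
  rw [Set.uIcc_of_le hw.1.le, Set.uIcc_of_le zero_le_one]
  exact Set.Icc_subset_Icc_right hw.2.le

/-- If the normalized incomplete beta functions
`F_a(w) = (∫₀^w t^(a-1)(1-t)^(a-1) dt)/(∫₀¹ t^(a-1)(1-t)^(a-1) dt)` for `a > 0` and `b > 0`
agree for all `w ∈ (0,1)`, then `a = b`. -/
theorem normalized_incomplete_beta_injective (a b : ℝ) (ha : 0 < a) (hb : 0 < b)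
    (h : ∀ w ∈ Set.Ioo (0 : ℝ) 1,
      (∫ t in (0 : ℝ)..w, t ^ (a - 1) * (1 - t) ^ (a - 1)) /
          (∫ t in (0 : ℝ)..1, t ^ (a - 1) * (1 - t) ^ (a - 1)) =
        (∫ t in (0 : ℝ)..w, t ^ (b - 1) * (1 - t) ^ (b - 1)) /
          (∫ t in (0 : ℝ)..1, t ^ (b - 1) * (1 - t) ^ (b - 1))) :
    a = b := by
  have hA := integral_rpow_mul_one_sub_rpow_pos ha ha
  have hB := integral_rpow_mul_one_sub_rpow_pos hb hb
  set A := ∫ t in (0 : ℝ)..1, t ^ (a - 1) * (1 - t) ^ (a - 1)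
  set B := ∫ t in (0 : ℝ)..1, t ^ (b - 1) * (1 - t) ^ (b - 1)
  have hdens : ∀ w ∈ Set.Ioo (0 : ℝ) 1,
      (w * (1 - w)) ^ (a - 1) / A = (w * (1 - w)) ^ (b - 1) / B := by
    intro w hw
    have hw' : 0 ≤ 1 - w := sub_nonneg.2 hw.2.le
    rw [Real.mul_rpow hw.1.le hw', Real.mul_rpow hw.1.le hw']
    refine ((hasDerivAt_integral_rpow_mul_one_sub_rpow ha ha hw).div_const A).unique
      (((hasDerivAt_integral_rpow_mul_one_sub_rpow hb hb hw).div_const B).congr_of_eventuallyEq ?_)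
    filter_upwards [isOpen_Ioo.mem_nhds hw] with x hx using h x hx
  have h₁ := hdens (1 / 2) (by norm_num)
  have h₂ := hdens (1 / 4) (by norm_num)
  have hsplit (c : ℝ) : ((1 : ℝ) / 2 * (1 - 1 / 2)) ^ c =
      (4 / 3) ^ c * (1 / 4 * (1 - 1 / 4)) ^ c := by
    rw [← Real.mul_rpow (by norm_num) (by norm_num)]
    norm_num
  rw [hsplit, hsplit, mul_div_assoc, mul_div_assoc, h₂] at h₁
  have hpos : 0 < ((1 : ℝ) / 4 * (1 - 1 / 4)) ^ (b - 1) / B :=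
    div_pos (Real.rpow_pos_of_pos (by norm_num) _) hB
  have hpow := mul_right_cancel₀ hpos.ne' h₁
  linarith [(Real.rpow_right_inj (by norm_num : (0 : ℝ) < 4 / 3) (by norm_num)).1 hpow]
end

section
/- Let a > 0 be a real number with a ≠ 1/3, and define F_a(w) = (∫₀^w t^(a-1)·(1-t)^(a-1) dt)/(∫₀¹ t^(a-1)·(1-t)^(a-1) dt). Then there exists w ∈ (0,1) such that F_a(w) ≠ F_{1/3}(w), where F_{1/3}(w) = (∫₀^w t^(-2/3)·(1-t)^(-2/3) dt)/(∫₀¹ t^(-2/3)·(1-t)^(-2/3) dt). -/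
open MeasureTheory intervalIntegral

/-- The parameter of a normalized symmetric incomplete beta function is determined by its
values on `(0,1)`. -/
theorem eq_of_eqOn_normalized_incomplete_beta {a b : ℝ} (ha : 0 < a) (hb : 0 < b)
    (h : ∀ w ∈ Set.Ioo (0 : ℝ) 1,
      (∫ t in (0 : ℝ)..w, t ^ (a - 1) * (1 - t) ^ (a - 1)) /
          (∫ t in (0 : ℝ)..1, t ^ (a - 1) * (1 - t) ^ (a - 1)) =
        (∫ t in (0 : ℝ)..w, t ^ (b - 1) * (1 - t) ^ (b - 1)) /
          (∫ t in (0 : ℝ)..1, t ^ (b - 1) * (1 - t) ^ (b - 1))) : a = b := by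
  have hA := integral_rpow_mul_one_sub_rpow_pos ha ha
  have hB := integral_rpow_mul_one_sub_rpow_pos hb hb
  set A := ∫ t in (0 : ℝ)..1, t ^ (a - 1) * (1 - t) ^ (a - 1)
  set B := ∫ t in (0 : ℝ)..1, t ^ (b - 1) * (1 - t) ^ (b - 1)
  have key : ∀ w ∈ Set.Ioo (0 : ℝ) 1, (w * (1 - w)) ^ (a - b) = A / B := by
    intro w hw
    have hd : w ^ (a - 1) * (1 - w) ^ (a - 1) / A = w ^ (b - 1) * (1 - w) ^ (b - 1) / B :=
      ((hasDerivAt_integral_rpow_mul_one_sub_rpow ha ha hw).div_const A).unique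
        (((hasDerivAt_integral_rpow_mul_one_sub_rpow hb hb hw).div_const B).congr_of_eventuallyEq
          (Filter.eventually_of_mem (isOpen_Ioo.mem_nhds hw) h))
    have hp : 0 < w * (1 - w) := mul_pos hw.1 (sub_pos.2 hw.2)
    rw [← Real.mul_rpow hw.1.le (sub_pos.2 hw.2).le,
      ← Real.mul_rpow hw.1.le (sub_pos.2 hw.2).le, div_eq_div_iff hA.ne' hB.ne'] at hd
    rw [show a - b = (a - 1) - (b - 1) by ring, Real.rpow_sub hp,
      div_eq_div_iff (Real.rpow_pos_of_pos hp _).ne' hB.ne', hd, mul_comm]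
  have h1 := (key (1 / 2) (by norm_num)).trans (key (1 / 4) (by norm_num)).symm
  by_contra hab
  have := (Real.rpow_left_inj (by norm_num) (by norm_num) (sub_ne_zero.2 hab)).1 h1
  norm_num at this

/-- For `a > 0` with `a ≠ 1/3`, the normalized incomplete beta function `F_a` differs
somewhere on `(0,1)` from `F_{1/3}`, the boundary Schwarz–Christoffel map onto the unit
equilateral triangle (equation (3.9) of the paper). -/
theorem exists_ne_of_base_angle_ne (a : ℝ) (ha : 0 < a) (ha' : a ≠ 1/3) :
    ∃ w ∈ Set.Ioo (0 : ℝ) 1,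
      (∫ t in (0 : ℝ)..w, t ^ (a - 1) * (1 - t) ^ (a - 1)) /
          (∫ t in (0 : ℝ)..1, t ^ (a - 1) * (1 - t) ^ (a - 1)) ≠
        (∫ t in (0 : ℝ)..w, t ^ (-2/3 : ℝ) * (1 - t) ^ (-2/3 : ℝ)) /
          (∫ t in (0 : ℝ)..1, t ^ (-2/3 : ℝ) * (1 - t) ^ (-2/3 : ℝ)) := by
  by_contra! h
  refine ha' (eq_of_eqOn_normalized_incomplete_beta ha (by norm_num) ?_)
  rw [show (1 / 3 - 1 : ℝ) = -2 / 3 by norm_num]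
  exact h
end

section
/- Let a, b > 0 and A₁, A₂ be real numbers with A₁ ≠ 0 and A₂ ≠ 0. Suppose x, X : (0,1) → ℝ are differentiable functions with x'(w) = A₁ · w^(a-1)·(1-w)^(a-1) and X'(w) = A₂ · w^(b-1)·(1-w)^(b-1) for all w ∈ (0,1). If x(w) = X(w) for all w ∈ (0,1), then a = b and A₁ = A₂. -/
/-- Two monomials `A * t ^ p` and `B * t ^ q` with `A ≠ 0` that agree at two distinct positive points
are equal. -/
theorem eq_and_eq_of_mul_rpow_eq {A B p q s t : ℝ} (hA : A ≠ 0) (hs : 0 < s) (ht : 0 < t)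
    (hst : s ≠ t) (h₁ : A * s ^ p = B * s ^ q) (h₂ : A * t ^ p = B * t ^ q) :
    p = q ∧ A = B := by
  have hpq : p = q := by
    have hr : t / s ≠ 1 := fun h => hst ((div_eq_one_iff_eq hs.ne').1 h).symm
    have hsp : 0 < s ^ p := Real.rpow_pos_of_pos hs p
    refine (Real.rpow_right_inj (div_pos ht hs) hr).1 ?_
    have hfac (r : ℝ) : t ^ r = s ^ r * (t / s) ^ r := by
      rw [← Real.mul_rpow hs.le (div_pos ht hs).le, mul_div_cancel₀ _ hs.ne']
    rw [hfac p, hfac q, ← mul_assoc, ← mul_assoc, ← h₁] at h₂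
    exact mul_left_cancel₀ (mul_ne_zero hA hsp.ne') h₂
  subst hpq
  exact ⟨rfl, mul_right_cancel₀ (Real.rpow_pos_of_pos hs p).ne' h₁⟩


/-- Suppose `x, X : ℝ → ℝ` satisfy, on `(0,1)`,
`x'(w) = A₁ * w^(a-1) * (1-w)^(a-1)` and `X'(w) = A₂ * w^(b-1) * (1-w)^(b-1)` with
`a, b > 0` and `A₁, A₂ ≠ 0`. If `x = X` on `(0,1)`, then `a = b` and `A₁ = A₂`
(the contradiction proving the paper's Theorem for `T_δ(k)`, `k ≠ 1`). -/
theorem SC_boundary_maps_eq_iff (a b A₁ A₂ : ℝ) (ha : 0 < a) (hb : 0 < b)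
    (hA₁ : A₁ ≠ 0) (hA₂ : A₂ ≠ 0) (x X : ℝ → ℝ)
    (hx : ∀ w ∈ Set.Ioo (0 : ℝ) 1,
      HasDerivAt x (A₁ * (w ^ (a - 1) * (1 - w) ^ (a - 1))) w)
    (hX : ∀ w ∈ Set.Ioo (0 : ℝ) 1,
      HasDerivAt X (A₂ * (w ^ (b - 1) * (1 - w) ^ (b - 1))) w)
    (hxX : ∀ w ∈ Set.Ioo (0 : ℝ) 1, x w = X w) :
    a = b ∧ A₁ = A₂ := by
  have key : ∀ w ∈ Set.Ioo (0 : ℝ) 1,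
      A₁ * (w * (1 - w)) ^ (a - 1) = A₂ * (w * (1 - w)) ^ (b - 1) := by
    intro w hw
    have heq : x =ᶠ[nhds w] X := by
      filter_upwards [isOpen_Ioo.mem_nhds hw] with v hv using hxX v hv
    have hw₁ : 0 ≤ 1 - w := sub_nonneg.2 hw.2.le
    rw [Real.mul_rpow hw.1.le hw₁, Real.mul_rpow hw.1.le hw₁]
    exact (hx w hw).unique ((hX w hw).congr_of_eventuallyEq heq)
  obtain ⟨hab, hA⟩ := eq_and_eq_of_mul_rpow_eq hA₁ (by norm_num) (by norm_num) (by norm_num)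
    (key (1 / 2) (by norm_num)) (key (1 / 4) (by norm_num))
  exact ⟨by linarith, hA⟩
end
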